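/- arXiv:2202.11801 — 2 statements merged into one kernel-verified Lean document; each statement's English description precedes it below -/
import Mathlib

section
/- Let A : ℝ^d → ℝ^{d×d}, B : ℝ^d → ℝ^{d×m}, W(x) := B(x)B(x)ᵀ, and let Q ∈ ℝ^{d×d} be symmetric. Let Π : ℝ^d → ℝ^{d×d} be differentiable with Π(x) symmetric, solving the state-dependent Riccati equation A(x)ᵀΠ(x) + Π(x)A(x) − Π(x)W(x)Π(x) + Q = 0 for every x ∈ ℝ^d. Define Ṽ(x) = ½ xᵀ Π(x) x and φ_k(x) = ½ ∑_{i,j} x_i x_j ∂_{x_k} Π_{i,j}(x). Then for every x ∈ ℝ^d, the residual obtained by substituting Ṽ into the Hamilton–Jacobi–Bellman equation satisfies min_{u ∈ ℝ^m} {(A(x)x + B(x)u)ᵀ ∇Ṽ(x) + ½ xᵀ Q x + ½ uᵀ u} = φ(x)ᵀ (A(x) − W(x)Π(x)) x − ½ φ(x)ᵀ W(x) φ(x), i.e. equals ½ φ(x)ᵀ (2[A(x) − W(x)Π(x)]x − W(x)φ(x)). -/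
open Matrix

/-- With `W = BBᵀ`, `Q` symmetric, `Π` differentiable, symmetric-valued and
solving the SDRE `AᵀΠ + ΠA - ΠWΠ + Q = 0` pointwise, `Ṽ(x) = ½xᵀΠ(x)x` and
`φ_k(x) = ½∑_{i,j} x_i x_j ∂_{x_k}Π_{i,j}(x)`, the residual obtained by substituting `Ṽ`
into the HJB equation satisfies, for every `x`,
`min_{u∈ℝ^m} {(A(x)x + B(x)u)ᵀ∇Ṽ(x) + ½xᵀQx + ½uᵀu}
   = φ(x)ᵀ(A(x) - W(x)Π(x))x - ½ φ(x)ᵀW(x)φ(x)`,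
i.e. equals `½ φ(x)ᵀ(2[A(x) - W(x)Π(x)]x - W(x)φ(x))`. -/
theorem hjb_residual_of_sdre_value_function
    {d m : ℕ} (A : (Fin d → ℝ) → Matrix (Fin d) (Fin d) ℝ)
    (B : (Fin d → ℝ) → Matrix (Fin d) (Fin m) ℝ)
    (W : (Fin d → ℝ) → Matrix (Fin d) (Fin d) ℝ)
    (hW : ∀ x : Fin d → ℝ, W x = B x * (B x)ᵀ)
    (Q : Matrix (Fin d) (Fin d) ℝ) (hQ : Q.IsSymm)
    (Pm : (Fin d → ℝ) → Matrix (Fin d) (Fin d) ℝ)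
    (hdiff : ∀ i j : Fin d, Differentiable ℝ (fun x : Fin d → ℝ => Pm x i j))
    (hsymm : ∀ x : Fin d → ℝ, (Pm x).IsSymm)
    (hsdre : ∀ x : Fin d → ℝ,
      (A x)ᵀ * Pm x + Pm x * A x - Pm x * W x * Pm x + Q = 0)
    (V : (Fin d → ℝ) → ℝ)
    (hV : ∀ x : Fin d → ℝ, V x = (1 / 2) * (x ⬝ᵥ (Pm x).mulVec x))
    (φ : (Fin d → ℝ) → (Fin d → ℝ))
    (hφ : ∀ (x : Fin d → ℝ) (k : Fin d),
      φ x k = (1 / 2) * ∑ i : Fin d, ∑ j : Fin d,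
        x i * x j * fderiv ℝ (fun y : Fin d → ℝ => Pm y i j) x (Pi.single k 1))
    (gradV : (Fin d → ℝ) → (Fin d → ℝ))
    (hgradV : ∀ (x : Fin d → ℝ) (k : Fin d), gradV x k = fderiv ℝ V x (Pi.single k 1)) :
    ∀ x : Fin d → ℝ,
      IsLeast
        {r : ℝ | ∃ u : Fin m → ℝ,
          r = ((A x).mulVec x + (B x).mulVec u) ⬝ᵥ gradV x
              + (1 / 2) * (x ⬝ᵥ Q.mulVec x) + (1 / 2) * (u ⬝ᵥ u)}
        (φ x ⬝ᵥ (A x - W x * Pm x).mulVec x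
          - (1 / 2) * (φ x ⬝ᵥ (W x).mulVec (φ x))) := by
  intro x
  have hg : gradV x = (Pm x).mulVec x + φ x := by
    funext k
    have hVf : V = fun y => (1 / 2) * ∑ i, ∑ j, y i * (Pm y i j * y j) := by
      funext y
      rw [hV y]
      simp only [dotProduct, mulVec, Finset.mul_sum]
    have hp : ∀ i : Fin d, HasFDerivAt (fun y : Fin d → ℝ => y i)
        (ContinuousLinearMap.proj (R := ℝ) (φ := fun _ : Fin d => ℝ) i) x :=
      fun i => hasFDerivAt_apply i x
    have hder := (HasFDerivAt.fun_sum (u := Finset.univ) (fun i _ =>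
      HasFDerivAt.fun_sum (u := Finset.univ) (fun j _ =>
        (hp i).mul (((hdiff i j) x).hasFDerivAt.mul (hp j))))).const_mul (1 / 2 : ℝ)
    have hder2 := hder.fderiv
    simp only [Pi.mul_apply] at hder2
    rw [← hVf] at hder2
    rw [hgradV, hder2, Pi.add_apply, hφ]
    have hs : ∀ i j, Pm x i j = Pm x j i := fun i j => (hsymm x).apply j i
    have e1 : ∑ i, ∑ j, x i * (Pm x i j * (Pi.single k (1 : ℝ) : Fin d → ℝ) j)
        = (Pm x).mulVec x k := by
      simp only [mulVec, dotProduct]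
      refine Finset.sum_congr rfl fun i _ => ?_
      rw [Finset.sum_eq_single k]
      · rw [hs i k]; simp [mul_comm]
      · intro b _ hb; simp [hb]
      · simp
    have e2 : ∑ i, ∑ j, (Pi.single k (1 : ℝ) : Fin d → ℝ) i * (Pm x i j * x j)
        = (Pm x).mulVec x k := by
      simp only [mulVec, dotProduct]
      rw [Finset.sum_eq_single k]
      · simp
      · intro b _ hb; simp [hb]
      · simp
    have e3 : (Pm x).mulVec x k = (1 / 2) *
        (∑ i, ∑ j, x i * (Pm x i j * (Pi.single k (1 : ℝ) : Fin d → ℝ) j)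
        + ∑ i, ∑ j, (Pi.single k (1 : ℝ) : Fin d → ℝ) i * (Pm x i j * x j)) := by
      rw [e1, e2]; ring
    rw [e3, ← mul_add, ← Finset.sum_add_distrib, ← Finset.sum_add_distrib]
    simp only [ContinuousLinearMap.smul_apply, ContinuousLinearMap.sum_apply,
      ContinuousLinearMap.add_apply, ContinuousLinearMap.proj_apply, smul_eq_mul]
    congr 1
    refine Finset.sum_congr rfl fun i _ => ?_
    rw [← Finset.sum_add_distrib, ← Finset.sum_add_distrib]
    refine Finset.sum_congr rfl fun j _ => ?_
    ring
  have hB : ∀ (u : Fin m → ℝ) (v : Fin d → ℝ),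
      (B x).mulVec u ⬝ᵥ v = u ⬝ᵥ (B x)ᵀ.mulVec v := by
    intro u v
    rw [dotProduct_comm, dotProduct_mulVec, ← mulVec_transpose, dotProduct_comm]
  have hPx : ∀ v : Fin d → ℝ, x ⬝ᵥ (Pm x).mulVec v = (Pm x).mulVec x ⬝ᵥ v := by
    intro v
    rw [dotProduct_mulVec, ← mulVec_transpose, (hsymm x).eq]
  have hAx : ∀ v : Fin d → ℝ, x ⬝ᵥ (A x)ᵀ.mulVec v = (A x).mulVec x ⬝ᵥ v := by
    intro v
    rw [dotProduct_mulVec, vecMul_transpose]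
  have hWv : ∀ v w : Fin d → ℝ,
      v ⬝ᵥ (W x).mulVec w = (B x)ᵀ.mulVec v ⬝ᵥ (B x)ᵀ.mulVec w := by
    intro v w
    rw [hW, ← mulVec_mulVec, dotProduct_comm, hB, dotProduct_comm]
  have hS := congrArg (fun M => x ⬝ᵥ M.mulVec x) (hsdre x)
  simp only [add_mulVec, sub_mulVec, ← mulVec_mulVec, dotProduct_add, dotProduct_sub,
    zero_mulVec, dotProduct_zero, hAx, hPx, hWv] at hS
  rw [dotProduct_comm ((Pm x).mulVec x) ((A x).mulVec x)] at hS
  have key : ∀ u : Fin m → ℝ,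
      ((A x).mulVec x + (B x).mulVec u) ⬝ᵥ gradV x
              + (1 / 2) * (x ⬝ᵥ Q.mulVec x) + (1 / 2) * (u ⬝ᵥ u)
      = (φ x ⬝ᵥ (A x - W x * Pm x).mulVec x
          - (1 / 2) * (φ x ⬝ᵥ (W x).mulVec (φ x)))
        + (1 / 2) * ((u + (B x)ᵀ.mulVec (gradV x)) ⬝ᵥ (u + (B x)ᵀ.mulVec (gradV x))) := by
    intro u
    rw [hg]
    simp only [sub_mulVec, ← mulVec_mulVec, dotProduct_add, add_dotProduct, dotProduct_sub,
      mulVec_add, hWv, hB]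
    rw [dotProduct_comm (φ x) ((A x).mulVec x),
      dotProduct_comm ((B x)ᵀ.mulVec (φ x)) ((B x)ᵀ.mulVec ((Pm x).mulVec x)),
      dotProduct_comm ((B x)ᵀ.mulVec (φ x)) u,
      dotProduct_comm ((B x)ᵀ.mulVec ((Pm x).mulVec x)) u]
    linarith
  constructor
  · refine ⟨-(B x)ᵀ.mulVec (gradV x), ?_⟩
    rw [key]
    simp
  · rintro r ⟨u, rfl⟩
    rw [key]
    have : 0 ≤ (u + (B x)ᵀ.mulVec (gradV x)) ⬝ᵥ (u + (B x)ᵀ.mulVec (gradV x)) :=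
      Finset.sum_nonneg fun i _ => mul_self_nonneg _
    linarith
end

section
/- With the setting of the residual formula (A, B, W = BBᵀ, symmetric Q, differentiable symmetric-valued Π solving the SDRE pointwise, Ṽ(x) = ½ xᵀΠ(x)x, and φ_k(x) = ½ ∑_{i,j} x_i x_j ∂_{x_k}Π_{i,j}(x)), suppose in addition that for every x ∈ ℝ^d the residual vanishes: φ(x)ᵀ(2[A(x) − W(x)Π(x)]x − W(x)φ(x)) = 0. Then Ṽ satisfies the Hamilton–Jacobi–Bellman equation: for every x ∈ ℝ^d, min_{u ∈ ℝ^m} {(A(x)x + B(x)u)ᵀ ∇Ṽ(x) + ½ xᵀ Q x + ½ uᵀ u} = 0. -/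
open Matrix

/-- In the setting of the residual formula (W = BBᵀ, Q symmetric, Π
differentiable, symmetric-valued and solving the SDRE pointwise, `Ṽ(x) = ½xᵀΠ(x)x`,
`φ_k(x) = ½∑_{i,j} x_i x_j ∂_{x_k}Π_{i,j}(x)`), if in addition the residual vanishes for
every `x`, i.e. `φ(x)ᵀ(2[A(x) - W(x)Π(x)]x - W(x)φ(x)) = 0`, then `Ṽ` satisfies the HJB
equation: `min_{u∈ℝ^m} {(A(x)x + B(x)u)ᵀ∇Ṽ(x) + ½xᵀQx + ½uᵀu} = 0` for every `x`. -/
theorem sdre_value_function_solves_hjb_of_zero_residual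
    {d m : ℕ} (A : (Fin d → ℝ) → Matrix (Fin d) (Fin d) ℝ)
    (B : (Fin d → ℝ) → Matrix (Fin d) (Fin m) ℝ)
    (W : (Fin d → ℝ) → Matrix (Fin d) (Fin d) ℝ)
    (hW : ∀ x : Fin d → ℝ, W x = B x * (B x)ᵀ)
    (Q : Matrix (Fin d) (Fin d) ℝ) (hQ : Q.IsSymm)
    (Pm : (Fin d → ℝ) → Matrix (Fin d) (Fin d) ℝ)
    (hdiff : ∀ i j : Fin d, Differentiable ℝ (fun x : Fin d → ℝ => Pm x i j))
    (hsymm : ∀ x : Fin d → ℝ, (Pm x).IsSymm)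
    (hsdre : ∀ x : Fin d → ℝ,
      (A x)ᵀ * Pm x + Pm x * A x - Pm x * W x * Pm x + Q = 0)
    (V : (Fin d → ℝ) → ℝ)
    (hV : ∀ x : Fin d → ℝ, V x = (1 / 2) * (x ⬝ᵥ (Pm x).mulVec x))
    (φ : (Fin d → ℝ) → (Fin d → ℝ))
    (hφ : ∀ (x : Fin d → ℝ) (k : Fin d),
      φ x k = (1 / 2) * ∑ i : Fin d, ∑ j : Fin d,
        x i * x j * fderiv ℝ (fun y : Fin d → ℝ => Pm y i j) x (Pi.single k 1))
    (gradV : (Fin d → ℝ) → (Fin d → ℝ))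
    (hgradV : ∀ (x : Fin d → ℝ) (k : Fin d), gradV x k = fderiv ℝ V x (Pi.single k 1))
    (hres : ∀ x : Fin d → ℝ,
      φ x ⬝ᵥ ((2 : ℝ) • ((A x - W x * Pm x).mulVec x) - (W x).mulVec (φ x)) = 0) :
    ∀ x : Fin d → ℝ,
      IsLeast
        {r : ℝ | ∃ u : Fin m → ℝ,
          r = ((A x).mulVec x + (B x).mulVec u) ⬝ᵥ gradV x
              + (1 / 2) * (x ⬝ᵥ Q.mulVec x) + (1 / 2) * (u ⬝ᵥ u)}
        0 := by
  intro x
  have hg : gradV x = (Pm x) *ᵥ x + φ x := by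
    funext k
    have hVe : V = fun y => (1 / 2) * ∑ i, ∑ j, y i * y j * Pm y i j := by
      funext y
      rw [hV y]
      simp only [dotProduct, mulVec, Finset.mul_sum]
      refine Finset.sum_congr rfl fun i _ => Finset.sum_congr rfl fun j _ => by ring
    have hd : HasFDerivAt (fun y : Fin d → ℝ => (1 / 2 : ℝ) * ∑ i, ∑ j, y i * y j * Pm y i j)
        ((1 / 2 : ℝ) • ∑ i, ∑ j, ((x i * x j) • fderiv ℝ (fun y : Fin d → ℝ => Pm y i j) x
          + (Pm x i j) • (x i • (ContinuousLinearMap.proj j : (Fin d → ℝ) →L[ℝ] ℝ)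
            + x j • (ContinuousLinearMap.proj i : (Fin d → ℝ) →L[ℝ] ℝ)))) x := by
      refine HasFDerivAt.const_mul ?_ _
      refine HasFDerivAt.fun_sum fun i _ => HasFDerivAt.fun_sum fun j _ => ?_
      exact ((hasFDerivAt_apply i x).mul (hasFDerivAt_apply j x)).mul
        ((hdiff i j) x).hasFDerivAt
    have h1 : ∑ i, ∑ j, Pm x i j * (x i * (Pi.single k 1 : Fin d → ℝ) j)
        = ((Pm x) *ᵥ x) k := by
      simp only [mulVec, dotProduct, Pi.single_apply, mul_ite, mul_one, mul_zero,
        Finset.sum_ite_eq', Finset.mem_univ, if_true]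
      refine Finset.sum_congr rfl fun i _ => ?_
      rw [(hsymm x).apply]
    have h2 : ∑ i, ∑ j, Pm x i j * (x j * (Pi.single k 1 : Fin d → ℝ) i)
        = ((Pm x) *ᵥ x) k := by
      rw [Finset.sum_comm]
      simp only [mulVec, dotProduct, Pi.single_apply, mul_ite, mul_one, mul_zero,
        Finset.sum_ite_eq', Finset.mem_univ, if_true]
    rw [hgradV, hVe, hd.fderiv, Pi.add_apply, hφ]
    simp only [_root_.smul_apply, _root_.sum_apply, _root_.add_apply,
      ContinuousLinearMap.proj_apply, smul_eq_mul, mul_add, Finset.sum_add_distrib] at *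
    rw [h1, h2]
    ring
  have hT : ∀ (v : Fin m → ℝ) (w : Fin d → ℝ), (B x *ᵥ v) ⬝ᵥ w = v ⬝ᵥ ((B x)ᵀ *ᵥ w) := by
    intro v w
    rw [mulVec_transpose, dotProduct_comm v, ← dotProduct_mulVec, dotProduct_comm]
  have hP : ∀ v w : Fin d → ℝ, v ⬝ᵥ (Pm x *ᵥ w) = (Pm x *ᵥ v) ⬝ᵥ w := by
    intro v w
    rw [dotProduct_mulVec, ← mulVec_transpose, (hsymm x).eq]
  have hq : x ⬝ᵥ (Q *ᵥ x) = -2 * ((A x *ᵥ x) ⬝ᵥ (Pm x *ᵥ x))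
      + ((B x)ᵀ *ᵥ (Pm x *ᵥ x)) ⬝ᵥ ((B x)ᵀ *ᵥ (Pm x *ᵥ x)) := by
    have h := congrArg (fun M => x ⬝ᵥ (M *ᵥ x)) (hsdre x)
    simp only [hW, add_mulVec, sub_mulVec, ← mulVec_mulVec, dotProduct_add, dotProduct_sub,
      zero_mulVec, dotProduct_zero] at h
    rw [hP, hP, dotProduct_comm (Pm x *ᵥ x) (B x *ᵥ _), hT, mulVec_transpose,
      dotProduct_comm x, ← dotProduct_mulVec, dotProduct_comm (Pm x *ᵥ x) (A x *ᵥ x)] at h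
    linarith
  have hr := hres x
  simp only [hW, sub_mulVec, ← mulVec_mulVec, dotProduct_sub, dotProduct_smul,
    smul_eq_mul] at hr
  rw [dotProduct_comm (φ x) (B x *ᵥ _), dotProduct_comm (φ x) (B x *ᵥ _), hT, hT,
    dotProduct_comm (φ x) (A x *ᵥ x)] at hr
  have key : ∀ u : Fin m → ℝ, ((A x).mulVec x + (B x).mulVec u) ⬝ᵥ gradV x
      + (1 / 2) * (x ⬝ᵥ Q.mulVec x) + (1 / 2) * (u ⬝ᵥ u)
      = (1 / 2) * ((u + (B x)ᵀ *ᵥ gradV x) ⬝ᵥ (u + (B x)ᵀ *ᵥ gradV x)) := by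
    intro u
    rw [hq, add_dotProduct, hT, hg]
    simp only [mulVec_add, dotProduct_add, add_dotProduct]
    rw [dotProduct_comm ((B x)ᵀ *ᵥ (Pm x *ᵥ x)) u, dotProduct_comm ((B x)ᵀ *ᵥ φ x) u,
      dotProduct_comm ((B x)ᵀ *ᵥ φ x) ((B x)ᵀ *ᵥ (Pm x *ᵥ x))]
    linarith
  constructor
  · refine ⟨-((B x)ᵀ *ᵥ gradV x), ?_⟩
    rw [key]
    simp
  · rintro r ⟨u, rfl⟩
    rw [key]
    have : ∀ v : Fin m → ℝ, 0 ≤ v ⬝ᵥ v := fun v =>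
      Finset.sum_nonneg fun i _ => mul_self_nonneg _
    linarith [this (u + (B x)ᵀ *ᵥ gradV x)]
end
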